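/- For every k ∈ ℕ, the graph G is k-colorable if and only if ∑_{V' ⊆ V} (−1)^{|V| − |V'|} · i(V')^k > 0 (as an integer). -/

import Mathlib

/-- `indepCount G X` is `i(X)`: the number of independent sets of `G`
contained in the finite vertex set `X`. -/
def indepCount {V : Type*} [DecidableEq V] (G : SimpleGraph V) [DecidableRel G.Adj]
    (X : Finset V) : ℕ :=
  (X.powerset.filter fun I => ∀ u ∈ I, ∀ v ∈ I, ¬ G.Adj u v).card

/-- Cardinality of the set of `k`-tuples of independent sets contained in `X`. -/
theorem card_indep_tuples {V : Type*} [Fintype V] [DecidableEq V] (G : SimpleGraph V)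
    [DecidableRel G.Adj] (k : ℕ) (X : Finset V) :
    (Fintype.piFinset fun _ : Fin k =>
      X.powerset.filter fun I => ∀ u ∈ I, ∀ v ∈ I, ¬ G.Adj u v).card = indepCount G X ^ k := by
  simp [Fintype.card_piFinset, indepCount]
  congr!

/-- The alternating sum counts the covers of `V` by `k` independent sets. -/
theorem sum_eq_card_covers {V : Type*} [Fintype V] [DecidableEq V] (G : SimpleGraph V)
    [DecidableRel G.Adj] (k : ℕ) :
    ∑ V' ∈ (Finset.univ : Finset V).powerset,
          (-1 : ℤ) ^ (Fintype.card V - V'.card) * (indepCount G V' : ℤ) ^ k =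
    ((Finset.univ.filter fun f : Fin k → {I : Finset V // ∀ u ∈ I, ∀ v ∈ I, ¬ G.Adj u v} =>
      ∀ v, ∃ i, v ∈ (f i).1).card : ℤ) := by
  have h := Finset.inclusion_exclusion_card_inf_compl (Finset.univ : Finset V)
    (fun v => Finset.univ.filter
      fun f : Fin k → {I : Finset V // ∀ u ∈ I, ∀ v ∈ I, ¬ G.Adj u v} => ∀ i, v ∉ (f i).1)
  have e : (Finset.univ.filter
      fun f : Fin k → {I : Finset V // ∀ u ∈ I, ∀ v ∈ I, ¬ G.Adj u v} =>
        ∀ v, ∃ i, v ∈ (f i).1) = Finset.univ.inf (fun v => (Finset.univ.filter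
      fun f : Fin k → {I : Finset V // ∀ u ∈ I, ∀ v ∈ I, ¬ G.Adj u v} =>
        ∀ i, v ∉ (f i).1)ᶜ) := by
    ext f
    simp [Finset.mem_inf]
  rw [e, h, Finset.powerset_univ]
  refine Finset.sum_equiv (Function.Involutive.toPerm (compl : Finset V → Finset V) compl_involutive) (by simp) ?_
  intro X _
  rw [← Nat.cast_pow, ← card_indep_tuples]
  simp only [Function.Involutive.coe_toPerm, Finset.card_compl]
  congr 2
  refine Finset.card_bij'
    (fun f hf i => ⟨f i, (Finset.mem_filter.1 (Fintype.mem_piFinset.1 hf i)).2⟩)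
    (fun f _ i => (f i).1) ?_ ?_ ?_ ?_
  · intro f hf
    simp only [Fintype.mem_piFinset, Finset.mem_filter, Finset.mem_powerset] at hf
    simp only [Finset.mem_inf, Finset.mem_filter, Finset.mem_univ, true_and, Finset.mem_compl]
    exact fun v hv i hi => hv ((hf i).1 hi)
  · intro f hf
    simp only [Finset.mem_inf, Finset.mem_filter, Finset.mem_univ, true_and,
      Finset.mem_compl] at hf
    simp only [Fintype.mem_piFinset, Finset.mem_filter, Finset.mem_powerset]
    exact fun i => ⟨fun v hv => by_contra fun hx => hf v hx i hv, (f i).2⟩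
  · intro f hf
    rfl
  · intro f hf
    rfl

/-- `G` is `k`-colorable iff `∑_{V' ⊆ V} (−1)^{|V|−|V'|} · i(V')^k > 0`. -/
theorem colorable_iff_inclusion_exclusion_pos
    {V : Type*} [Fintype V] [DecidableEq V] (G : SimpleGraph V) [DecidableRel G.Adj]
    (k : ℕ) :
    (∃ c : V → Fin k, ∀ u v : V, G.Adj u v → c u ≠ c v)
      ↔ 0 < ∑ V' ∈ (Finset.univ : Finset V).powerset,
          (-1 : ℤ) ^ (Fintype.card V - V'.card) * (indepCount G V' : ℤ) ^ k := by
  rw [sum_eq_card_covers, Nat.cast_pos, Finset.card_pos]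
  constructor
  · rintro ⟨c, hc⟩
    refine ⟨fun i => ⟨Finset.univ.filter fun v => c v = i, ?_⟩, ?_⟩
    · intro u hu v hv huv
      simp only [Finset.mem_filter, Finset.mem_univ, true_and] at hu hv
      exact hc u v huv (hu.trans hv.symm)
    · simp
  · rintro ⟨f, hf⟩
    simp only [Finset.mem_filter, Finset.mem_univ, true_and] at hf
    choose c hc using hf
    refine ⟨c, fun u v huv h => (f (c u)).2 u (hc u) v ?_ huv⟩
    rw [h]
    exact hc v
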